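/- For every prime p > 5, the number 2 · 3 · 5^{⌊(p−1)/4⌋} · p is a primitive covering number. -/

import Mathlib

/-- A positive integer `n` is a *covering number* if there is a finite system of
residue classes `aᵢ (mod mᵢ)` covering all of `ℤ`, whose moduli `mᵢ` are distinct,
all greater than `1`, and all divide `n`. -/
def IsCoveringNumber (n : ℕ) : Prop :=
  ∃ (k : ℕ) (a : Fin k → ℤ) (m : Fin k → ℕ),
    Function.Injective m ∧
    (∀ i, 1 < m i) ∧ (∀ i, m i ∣ n) ∧
    (∀ x : ℤ, ∃ i, (m i : ℤ) ∣ x - a i)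

/-- A covering number is *primitive* if none of its proper divisors is a covering number. -/
def IsPrimitiveCoveringNumber (n : ℕ) : Prop :=
  IsCoveringNumber n ∧ ∀ d : ℕ, d ∣ n → d ≠ n → ¬ IsCoveringNumber d

/-- `c` assigns to every divisor `d` of `n` other than `1` a residue class `c d (mod d)`;
an integer is hit when it belongs to one of these classes. -/
def HitByDivisorClass (n : ℕ) (c : ℕ → ℤ) (x : ℤ) : Prop :=
  ∃ d : ℕ, d ∣ n ∧ d ≠ 1 ∧ (d : ℤ) ∣ x - c d

theorem isCoveringNumber_iff {n : ℕ} (hn : n ≠ 0) :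
    IsCoveringNumber n ↔ ∃ c : ℕ → ℤ, ∀ x : ℤ, HitByDivisorClass n c x := by
  constructor
  · rintro ⟨k, a, m, hinj, hm1, hmn, hcov⟩
    refine ⟨Function.extend m a 0, fun x => ?_⟩
    obtain ⟨i, hi⟩ := hcov x
    exact ⟨m i, hmn i, (hm1 i).ne', by rwa [hinj.extend_apply]⟩
  · rintro ⟨c, hc⟩
    let e := (n.divisors.erase 1).equivFin
    have hmem (i) : (e.symm i : ℕ) ≠ 1 ∧ (e.symm i : ℕ) ∣ n := by
      have h := (e.symm i).2
      rw [Finset.mem_erase, Nat.mem_divisors] at h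
      exact ⟨h.1, h.2.1⟩
    refine ⟨_, fun i => c (e.symm i), fun i => e.symm i,
      Subtype.val_injective.comp e.symm.injective, fun i => ?_, fun i => (hmem i).2, fun x => ?_⟩
    · exact Nat.one_lt_iff_ne_zero_and_ne_one.mpr
        ⟨ne_zero_of_dvd_ne_zero hn (hmem i).2, (hmem i).1⟩
    · obtain ⟨d, hdn, hd1, hdx⟩ := hc x
      refine ⟨e ⟨d, ?_⟩, ?_⟩
      · simp [hdn, hd1, hn]
      · simpa using hdx

theorem IsCoveringNumber.mono {m n : ℕ} (h : IsCoveringNumber m) (hmn : m ∣ n) :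
    IsCoveringNumber n := by
  obtain ⟨k, a, f, hinj, h1, hd, hc⟩ := h
  exact ⟨k, a, f, hinj, h1, fun i => (hd i).trans hmn, hc⟩

theorem not_isCoveringNumber_one : ¬ IsCoveringNumber 1 := by
  rintro ⟨k, a, m, -, h1, hd, hc⟩
  obtain ⟨i, -⟩ := hc 0
  have := h1 i
  have := Nat.dvd_one.mp (hd i)
  omega

/-- A divisor of `q ^ (b + 1) * K` that does not divide `q ^ b * K` is `q ^ (b + 1)` times a
divisor of `K`. -/
theorem exists_eq_pow_succ_mul_of_dvd {q b K d : ℕ} (hq : q.Prime)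
    (hd : d ∣ q ^ (b + 1) * K) (hd' : ¬ d ∣ q ^ b * K) : ∃ e, e ∣ K ∧ d = q ^ (b + 1) * e := by
  obtain ⟨u, e, hu, he, rfl⟩ := (Nat.dvd_mul).mp hd
  obtain ⟨i, hi, rfl⟩ := (Nat.dvd_prime_pow hq).mp hu
  rcases hi.lt_or_eq with hi | rfl
  · exact absurd (mul_dvd_mul (pow_dvd_pow q (Nat.lt_succ_iff.mp hi)) he) hd'
  · exact ⟨e, he, rfl⟩

/-- If `K` has fewer than `q` divisors, then the classes whose moduli are divisible by
`q ^ (b + 1)` are superfluous in a cover with moduli dividing `q ^ (b + 1) * K`. -/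
theorem IsCoveringNumber.of_pow_succ_mul {q b K : ℕ} (hq : q.Prime) (hqK : ¬ q ∣ K)
    (hK : K.divisors.card < q) (h : IsCoveringNumber (q ^ (b + 1) * K)) :
    IsCoveringNumber (q ^ b * K) := by
  have hK0 : K ≠ 0 := by rintro rfl; simp at hqK
  have hq0 := hq.ne_zero
  rw [isCoveringNumber_iff (by positivity)] at h ⊢
  obtain ⟨c, hc⟩ := h
  refine ⟨c, fun x => ?_⟩
  by_contra hx
  have key (j : ℕ) : ∃ e ∈ K.divisors,
      ((q ^ (b + 1) * e : ℕ) : ℤ) ∣ x + (q ^ b * K : ℕ) * j - c (q ^ (b + 1) * e) := by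
    obtain ⟨d, hdn, hd1, hdx⟩ := hc (x + (q ^ b * K : ℕ) * j)
    have hd : ¬ d ∣ q ^ b * K := fun hd => hx ⟨d, hd, hd1, by
      have h2 : (d : ℤ) ∣ (q ^ b * K : ℕ) * j := (Int.natCast_dvd_natCast.mpr hd).mul_right _
      have := dvd_sub hdx h2
      ring_nf at this ⊢
      exact this⟩
    obtain ⟨e, he, rfl⟩ := exists_eq_pow_succ_mul_of_dvd hq hdn hd
    exact ⟨e, Nat.mem_divisors.mpr ⟨he, hK0⟩, hdx⟩
  choose f hf hfx using key
  obtain ⟨i, hi, j, hj, hij, hfij⟩ := Finset.exists_ne_map_eq_of_card_lt_of_maps_to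
    (s := Finset.range q) (t := K.divisors) (by simpa using hK) (f := f) (fun i _ => hf i)
  have h1 := hfx i
  rw [hfij] at h1
  have h2 := dvd_sub h1 (hfx j)
  have h3 : ((q : ℤ) ^ b * q) ∣ q ^ b * (K * ((i : ℤ) - j)) := by
    refine dvd_trans ⟨(f j : ℤ), ?_⟩ (h2.trans (dvd_of_eq ?_))
    · push_cast; ring
    · push_cast; ring
  have h4 := (mul_dvd_mul_iff_left (by positivity)).mp h3
  rcases (Nat.prime_iff_prime_int.mp hq).dvd_or_dvd h4 with h5 | h5
  · exact hqK (Int.natCast_dvd_natCast.mp h5)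
  · rw [Finset.mem_range] at hi hj
    have := Int.eq_zero_of_abs_lt_dvd h5 (by rw [abs_lt]; omega)
    omega

theorem not_isCoveringNumber_pow_mul {q K : ℕ} (hq : q.Prime) (hqK : ¬ q ∣ K)
    (hK : K.divisors.card < q) (h : ¬ IsCoveringNumber K) (b : ℕ) :
    ¬ IsCoveringNumber (q ^ b * K) := by
  induction b with
  | zero => simpa using h
  | succ b ih => exact fun h' => ih (h'.of_pow_succ_mul hq hqK hK)

/-- Classes covering all integers outside `0 (mod q ^ b * K)` can be supplemented by classes with
moduli `q ^ (b + 1) * e` with `e ∣ K`, which cover as many classes modulo `q ^ (b + 1) * K` inside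
`0 (mod q ^ b * K)` as `K` has divisors. -/
theorem exists_hit_or_of_dvd_or_hit {q b K : ℕ} (hq : q.Prime) (hqK : ¬ q ∣ K) {c : ℕ → ℤ}
    (hc : ∀ x : ℤ, ((q ^ b * K : ℕ) : ℤ) ∣ x ∨ HitByDivisorClass (q ^ b * K) c x) :
    ∃ c' : ℕ → ℤ, ∀ x : ℤ, HitByDivisorClass (q ^ (b + 1) * K) c' x ∨
      ∃ t : ℤ, x = (q ^ b * K : ℕ) * t ∧
        ∀ j : ℕ, 1 ≤ j → j ≤ K.divisors.card → ¬ (q : ℤ) ∣ t - j := by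
  let g := K.divisors.equivFin
  let φ : ℕ → ℕ := fun e => if h : e ∈ K.divisors then (g ⟨e, h⟩ : ℕ) + 1 else 0
  have hφ (j : ℕ) (h1 : 1 ≤ j) (h2 : j ≤ K.divisors.card) : ∃ e, e ∣ K ∧ φ e = j := by
    refine ⟨g.symm ⟨j - 1, by omega⟩, Nat.dvd_of_mem_divisors (g.symm ⟨j - 1, by omega⟩).2, ?_⟩
    simp only [φ, Subtype.coe_eta, Finset.coe_mem, dite_true, Equiv.apply_symm_apply]
    omega
  have hpos : 0 < q ^ (b + 1) := pow_pos hq.pos _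
  refine ⟨fun d => if d ∣ q ^ b * K then c d else (q ^ b * K : ℕ) * φ (d / q ^ (b + 1)),
    fun x => ?_⟩
  rcases hc x with ⟨t, rfl⟩ | ⟨d, hd, hd1, hdx⟩
  · by_cases ht : ∀ j : ℕ, 1 ≤ j → j ≤ K.divisors.card → ¬ (q : ℤ) ∣ t - j
    · exact Or.inr ⟨t, rfl, ht⟩
    push Not at ht
    obtain ⟨j, hj1, hj2, s, hs⟩ := ht
    obtain ⟨e, ⟨f, rfl⟩, he⟩ := hφ j hj1 hj2
    refine Or.inl ⟨q ^ (b + 1) * e, ⟨f, by ring⟩, fun h => ?_, ?_⟩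
    · exact hq.one_lt.ne' (Nat.dvd_one.mp (h ▸ (dvd_pow_self q b.succ_ne_zero).mul_right e))
    · have hnot : ¬ q ^ (b + 1) * e ∣ q ^ b * (e * f) := fun h => by
        have h' := (dvd_mul_right (q ^ (b + 1)) e).trans h
        rw [pow_succ] at h'
        exact hqK (Nat.dvd_of_mul_dvd_mul_left (pow_pos hq.pos b) h')
      simp only [if_neg hnot, Nat.mul_div_cancel_left e hpos, he]
      refine ⟨f * s, ?_⟩
      push_cast
      linear_combination (q : ℤ) ^ b * (e * f) * hs
  · refine Or.inl ⟨d, hd.trans ⟨q, by ring⟩, hd1, ?_⟩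
    simpa only [if_pos hd] using hdx

/-- If `K` has at least `q - 1` divisors, then covers of the integers outside `0 (mod K)` extend to
covers of the integers outside `0 (mod q ^ b * K)`. -/
theorem exists_dvd_or_hit_pow_mul {q K : ℕ} (hq : q.Prime) (hqK : ¬ q ∣ K)
    (hK : q ≤ K.divisors.card + 1)
    (h : ∃ c : ℕ → ℤ, ∀ x : ℤ, (K : ℤ) ∣ x ∨ HitByDivisorClass K c x) (b : ℕ) :
    ∃ c : ℕ → ℤ, ∀ x : ℤ, ((q ^ b * K : ℕ) : ℤ) ∣ x ∨ HitByDivisorClass (q ^ b * K) c x := by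
  induction b with
  | zero => simpa using h
  | succ b ih =>
    obtain ⟨c, hc⟩ := ih
    obtain ⟨c', hc'⟩ := exists_hit_or_of_dvd_or_hit hq hqK hc
    refine ⟨c', fun x => (hc' x).symm.imp_left ?_⟩
    rintro ⟨t, rfl, ht⟩
    have hq' : (0 : ℤ) < q := mod_cast hq.pos
    have h0 := Int.emod_nonneg t hq'.ne'
    have hlt := Int.emod_lt_of_pos t hq'
    have hqt : (q : ℤ) ∣ t := by
      by_contra hne
      rw [Int.dvd_iff_emod_eq_zero] at hne
      refine ht (t % q).toNat (by omega) (by omega) ?_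
      rw [Int.toNat_of_nonneg h0]
      exact Int.dvd_self_sub_emod
    obtain ⟨s, rfl⟩ := hqt
    exact ⟨s, by push_cast; ring⟩

/-- If `K` has at least `q` divisors, then covers of the integers outside `0 (mod K)` extend to
covers of all integers with moduli dividing `q * K`. -/
theorem isCoveringNumber_mul {q K : ℕ} (hq : q.Prime) (hqK : ¬ q ∣ K)
    (hK : q ≤ K.divisors.card)
    (h : ∃ c : ℕ → ℤ, ∀ x : ℤ, (K : ℤ) ∣ x ∨ HitByDivisorClass K c x) :
    IsCoveringNumber (q * K) := by
  have hK0 : K ≠ 0 := by rintro rfl; simp at hqK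
  rw [isCoveringNumber_iff (mul_ne_zero hq.ne_zero hK0)]
  obtain ⟨c, hc⟩ := h
  obtain ⟨c', hc'⟩ := exists_hit_or_of_dvd_or_hit (b := 0) hq hqK (c := c) (by simpa using hc)
  refine ⟨c', fun x => ?_⟩
  rcases hc' x with hx | ⟨t, -, ht⟩
  · simpa using hx
  · exfalso
    have hq' : (0 : ℤ) < q := mod_cast hq.pos
    have h0 := Int.emod_nonneg (t - 1) hq'.ne'
    have hlt := Int.emod_lt_of_pos (t - 1) hq'
    refine ht ((t - 1) % q + 1).toNat (by omega) (by omega) ?_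
    rw [Int.toNat_of_nonneg (by omega), ← sub_sub, sub_right_comm]
    exact Int.dvd_self_sub_emod

theorem card_divisors_five_pow_mul {K : ℕ} (hK : ¬ 5 ∣ K) (b : ℕ) :
    (5 ^ b * K).divisors.card = (b + 1) * K.divisors.card := by
  have h5 : Nat.Prime 5 := by norm_num
  rw [Nat.Coprime.card_divisors_mul (((h5.coprime_iff_not_dvd).mpr hK).pow_left b),
    Nat.divisors_prime_pow h5, Finset.card_map, Finset.card_range]

theorem exists_prime_dvd_div_of_dvd_of_ne {d n : ℕ} (hn : n ≠ 0) (hd : d ∣ n) (hne : d ≠ n) :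
    ∃ q m, q.Prime ∧ n = q * m ∧ d ∣ m := by
  obtain ⟨k, rfl⟩ := hd
  have hk : k ≠ 1 := by rintro rfl; simp at hne
  obtain ⟨q, hq, l, rfl⟩ := Nat.exists_prime_and_dvd hk
  exact ⟨q, d * l, hq, by ring, dvd_mul_right d l⟩

theorem stmt9 (p : ℕ) (hp : p.Prime) (h5 : 5 < p) :
    IsPrimitiveCoveringNumber (2 * 3 * 5 ^ ((p - 1) / 4) * p) := by
  have hprime5 : Nat.Prime 5 := by norm_num
  have hpodd : p % 2 = 1 := hp.eq_two_or_odd.resolve_left (by omega)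
  obtain ⟨a, ha⟩ : ∃ a, a + 1 = (p - 1) / 4 := ⟨(p - 1) / 4 - 1, by omega⟩
  rw [← ha]
  have hpK {K : ℕ} (hK : K ∣ 6) (b : ℕ) : ¬ p ∣ 5 ^ b * K := fun h => by
    rcases hp.dvd_mul.mp h with h | h
    · have := Nat.le_of_dvd (by norm_num) (hp.dvd_of_dvd_pow h)
      omega
    · have h6 : p ∣ 2 * 3 := h.trans hK
      rcases hp.dvd_mul.mp h6 with h | h <;> have := Nat.le_of_dvd (by norm_num) h <;> omega
  have card2 : (2 : ℕ).divisors.card = 2 := by decide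
  have card3 : (3 : ℕ).divisors.card = 2 := by decide
  have card6 : (6 : ℕ).divisors.card = 4 := by decide
  have not2 : ¬ IsCoveringNumber 2 := by
    simpa using not_isCoveringNumber_pow_mul (q := 2) (K := 1) (by norm_num) (by norm_num)
      (by simp) not_isCoveringNumber_one 1
  have not3 : ¬ IsCoveringNumber 3 := by
    simpa using not_isCoveringNumber_pow_mul (q := 3) (K := 1) (by norm_num) (by norm_num)
      (by simp) not_isCoveringNumber_one 1
  have not6 : ¬ IsCoveringNumber 6 := by
    simpa using not_isCoveringNumber_pow_mul (q := 3) (K := 2) (by norm_num) (by norm_num)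
      (by simp [card2]) not2 1
  have notp {K b : ℕ} (hK : K ∣ 6) (hK5 : K.divisors.card < 5) (hnot : ¬ IsCoveringNumber K)
      (hb : (b + 1) * K.divisors.card < p) : ¬ IsCoveringNumber (p * (5 ^ b * K)) := by
    have h5K : ¬ 5 ∣ K := fun h => absurd (h.trans hK) (by norm_num)
    simpa using not_isCoveringNumber_pow_mul hp (hpK hK b)
      (by rwa [card_divisors_five_pow_mul h5K])
      (not_isCoveringNumber_pow_mul hprime5 h5K hK5 hnot b) 1
  have hn : 2 * 3 * 5 ^ (a + 1) * p = p * (5 ^ (a + 1) * 6) := by ring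
  refine ⟨?_, fun d hd hne hcov => ?_⟩
  · rw [hn]
    refine isCoveringNumber_mul hp (hpK dvd_rfl _)
      (by rw [card_divisors_five_pow_mul (by norm_num), card6]; omega)
      (exists_dvd_or_hit_pow_mul hprime5 (by norm_num) (by simp [card6]) ?_ _)
    have h1 : ∃ c : ℕ → ℤ, ∀ x : ℤ, ((1 : ℕ) : ℤ) ∣ x ∨ HitByDivisorClass 1 c x :=
      ⟨0, fun x => Or.inl (by simp)⟩
    have h2 := exists_dvd_or_hit_pow_mul (q := 2) (by norm_num) (by norm_num) (by simp) h1 1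
    simpa using exists_dvd_or_hit_pow_mul (q := 3) (by norm_num) (by norm_num)
      (by simp [card2]) h2 1
  · have hp0 := hp.pos
    obtain ⟨q, m, hq, hqm, hdm⟩ := exists_prime_dvd_div_of_dvd_of_ne (by positivity) hd hne
    have hcovm := hcov.mono hdm
    have hcancel {m' : ℕ} (h : 2 * 3 * 5 ^ (a + 1) * p = q * m') : m = m' :=
      Nat.eq_of_mul_eq_mul_left hq.pos (hqm.symm.trans h)
    have hqn : q ∣ 2 * 3 * 5 ^ (a + 1) * p := ⟨m, hqm⟩
    rw [hq.dvd_mul, hq.dvd_mul, hq.dvd_mul, Nat.prime_dvd_prime_iff_eq hq Nat.prime_two,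
      Nat.prime_dvd_prime_iff_eq hq Nat.prime_three, Nat.prime_dvd_prime_iff_eq hq hp] at hqn
    rcases hqn with ((rfl | rfl) | h) | rfl
    · rw [hcancel (m' := p * (5 ^ (a + 1) * 3)) (by ring)] at hcovm
      exact notp (by norm_num) (by simp [card3]) not3 (by rw [card3]; omega) hcovm
    · rw [hcancel (m' := p * (5 ^ (a + 1) * 2)) (by ring)] at hcovm
      exact notp (by norm_num) (by simp [card2]) not2 (by rw [card2]; omega) hcovm
    · obtain rfl := (Nat.prime_dvd_prime_iff_eq hq hprime5).mp (hq.dvd_of_dvd_pow h)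
      rw [hcancel (m' := p * (5 ^ a * 6)) (by ring)] at hcovm
      exact notp dvd_rfl (by simp [card6]) not6 (by rw [card6]; omega) hcovm
    · rw [hcancel (m' := 5 ^ (a + 1) * 6) (by ring)] at hcovm
      exact not_isCoveringNumber_pow_mul hprime5 (by norm_num) (by simp [card6]) not6 _ hcovm
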